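/- Let f be a homeomorphism of the open unit disk 𝔻, let n ≥ 1 be an integer, and for each i ∈ ℤ/nℤ let z_i ∈ 𝔻 and α_i, ω_i ∈ S¹ be such that the 2n points α_i, ω_i (i ∈ ℤ/nℤ) are pairwise distinct, f^k(z_i) → α_i as k → −∞ and f^k(z_i) → ω_i as k → +∞. Set O_i = {f^m(z_i) : m ∈ ℤ}. Suppose given segments γ_i^k (i ∈ ℤ/nℤ, k ∈ ℤ) in 𝔻 such that: each γ_i^k is a translation arc for f joining f^k(z_i) to f^{k+1}(z_i); f(γ_i^k) ∩ γ_i^{k'} = ∅ whenever k' < k; (γ_i^k) converges to {α_i} as k → −∞ and to {ω_i} as k → +∞. Then there exist segments γ̃_i^k (i ∈ ℤ/nℤ, k ∈ ℤ) satisfying all of the above properties and, in addition: γ̃_i^k ∩ O_i = {f^k(z_i), f^{k+1}(z_i)}; γ̃_i^k ∩ O_{i'} = ∅ whenever i' ≠ i; γ̃_i^k ∩ γ̃_{i'}^{k'} is finite whenever (i',k') ∉ {(i,k−1), (i,k), (i,k+1)}; and γ̃_i^k ∩ γ̃_{i'}^{k'} ∩ γ̃_{i''}^{k''} = ∅ whenever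 (i,k), (i',k'), (i'',k'') are pairwise distinct. (Proposition 4.1.) -/

import Mathlib

open Set Filter Metric Topology

noncomputable section

/-- The open unit disk in the complex plane. -/
abbrev Disk : Set ℂ := Metric.ball 0 1

/-- The `k`-th iterate (`k ∈ ℤ`) of a homeomorphism of the open unit disk. -/
def fiter (f : ↥Disk ≃ₜ ↥Disk) (k : ℤ) : ↥Disk → ↥Disk := fun z => (f.toEquiv ^ k) z

/-- A subset `X` of the disk is free for `f` if `f(X) ∩ X = ∅`. -/
def IsFreeSet (f : ↥Disk ≃ₜ ↥Disk) (X : Set ↥Disk) : Prop := (⇑f '' X) ∩ X = ∅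

/-- An open disk: an open subset of `Disk` homeomorphic to `Disk`. -/
def IsOpenDisk (U : Set ↥Disk) : Prop := IsOpen U ∧ Nonempty (↥U ≃ₜ ↥Disk)

/-- `f` is recurrent: there is a closed chain of pairwise disjoint free open disks. -/
def RecurrentHomeo (f : ↥Disk ≃ₜ ↥Disk) : Prop :=
  ∃ r : ℕ, 1 ≤ r ∧ ∃ X : ZMod r → Set ↥Disk,
    (∀ i, IsOpenDisk (X i)) ∧ (∀ i, IsFreeSet f (X i)) ∧
    (Pairwise fun i j => Disjoint (X i) (X j)) ∧
    (∀ i, ∃ k : ℤ, 1 ≤ k ∧ ((fiter f k '' X i) ∩ X (i + 1)).Nonempty)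

/-- `γ` is a segment of the disk joining `a` to `b`: the image of an injective
continuous map defined on `[0,1]` sending `0` to `a` and `1` to `b`. -/
def IsSegment (γ : Set ↥Disk) (a b : ↥Disk) : Prop :=
  ∃ g : ℝ → ↥Disk, ContinuousOn g (Set.Icc 0 1) ∧ Set.InjOn g (Set.Icc 0 1) ∧
    g 0 = a ∧ g 1 = b ∧ γ = g '' Set.Icc 0 1

/-- `γ` is a segment (with some endpoints). -/
def IsSegmentSet (γ : Set ↥Disk) : Prop := ∃ a b, IsSegment γ a b

/-- A translation arc for `f` at `z`. -/
def IsTranslationArc (f : ↥Disk ≃ₜ ↥Disk) (z : ↥Disk) (γ : Set ↥Disk) : Prop :=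
  f z ≠ z ∧ IsSegment γ z (f z) ∧
  (f (f z) = z → (⇑f '' γ) ∩ γ = {z, f z}) ∧
  (f (f z) ≠ z → (⇑f '' γ) ∩ γ = {f z})

/-- A closed disk: a subset of `Disk` homeomorphic to the closed unit disk. -/
def IsClosedDisk (D : Set ↥Disk) : Prop := Nonempty (↥D ≃ₜ ↥(Metric.closedBall (0:ℂ) 1))

/-- A `ℤ`-indexed family of subsets of the disk converges to `{p}` as `k → +∞`. -/
def TendstoSetsTop (A : ℤ → Set ↥Disk) (p : ℂ) : Prop :=
  ∀ ε > (0 : ℝ), ∃ N : ℤ, ∀ k ≥ N, ∀ x ∈ A k, dist x.1 p < ε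

/-- A `ℤ`-indexed family of subsets of the disk converges to `{p}` as `k → -∞`. -/
def TendstoSetsBot (A : ℤ → Set ↥Disk) (p : ℂ) : Prop :=
  ∀ ε > (0 : ℝ), ∃ N : ℤ, ∀ k ≤ N, ∀ x ∈ A k, dist x.1 p < ε

/-- The orbit `{f^m(z) : m ∈ ℤ}` of a point `z` of the disk. -/
def orbitSet (f : ↥Disk ≃ₜ ↥Disk) (z : ↥Disk) : Set ↥Disk :=
  Set.range fun m : ℤ => fiter f m z


/-! ### Arcs inside a set -/

/-- `a` and `b` are joined by a (possibly degenerate) arc contained in `S`. -/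
def ArcIn (S : Set ↥Disk) (a b : ↥Disk) : Prop :=
  ∃ s t : ℝ, ∃ g : ℝ → ↥Disk, s ≤ t ∧ ContinuousOn g (Icc s t) ∧ InjOn g (Icc s t) ∧
    g s = a ∧ g t = b ∧ MapsTo g (Icc s t) S

theorem ArcIn.mono {S T : Set ↥Disk} (h : S ⊆ T) {a b : ↥Disk} (hab : ArcIn S a b) :
    ArcIn T a b := by
  obtain ⟨s, t, g, h1, h2, h3, h4, h5, h6⟩ := hab
  exact ⟨s, t, g, h1, h2, h3, h4, h5, fun x hx => h (h6 hx)⟩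

theorem ArcIn.symm {S : Set ↥Disk} {a b : ↥Disk} (hab : ArcIn S a b) : ArcIn S b a := by
  obtain ⟨s, t, g, h1, h2, h3, h4, h5, h6⟩ := hab
  have hm : MapsTo (fun x : ℝ => -x) (Icc (-t) (-s)) (Icc s t) := by
    intro x hx
    simp only [mem_Icc] at hx ⊢
    constructor <;> linarith [hx.1, hx.2]
  refine ⟨-t, -s, fun x => g (-x), by linarith, ?_, ?_, by simp [h5], by simp [h4], ?_⟩
  · exact h2.comp continuous_neg.continuousOn hm
  · intro x hx y hy hxy
    exact neg_injective (h3 (hm hx) (hm hy) hxy)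
  · intro x hx
    exact h6 (hm hx)

theorem ArcIn.trans {S : Set ↥Disk} {a b c : ↥Disk} (hab : ArcIn S a b) (hbc : ArcIn S b c) :
    ArcIn S a c := by
  obtain ⟨s, t, g, h1, h2, h3, h4, h5, h6⟩ := hab
  obtain ⟨s', t', h, k1, k2, k3, k4, k5, k6⟩ := hbc
  have hK : IsClosed (h '' Icc s' t') := (isCompact_Icc.image_of_continuousOn k2).isClosed
  have hC : IsClosed (Icc s t ∩ g ⁻¹' (h '' Icc s' t')) :=
    h2.preimage_isClosed_of_isClosed isClosed_Icc hK
  have hC' : IsCompact (Icc s t ∩ g ⁻¹' (h '' Icc s' t')) :=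
    isCompact_Icc.of_isClosed_subset hC inter_subset_left
  have hne : (Icc s t ∩ g ⁻¹' (h '' Icc s' t')).Nonempty :=
    ⟨t, ⟨h1, le_rfl⟩, s', ⟨le_rfl, k1⟩, by rw [k4, h5]⟩
  obtain ⟨u, ⟨hu, hu'⟩, hleast⟩ := hC'.exists_isLeast hne
  obtain ⟨v, hv, hvu⟩ := hu'
  have hfirst : ∀ x ∈ Icc s u, ∀ y ∈ Icc v t', g x = h y → x = u ∧ y = v := by
    intro x hx y hy hxy
    have hx' : u ≤ x := hleast ⟨⟨hx.1, hx.2.trans hu.2⟩, y, ⟨hv.1.trans hy.1, hy.2⟩, hxy.symm⟩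
    have hxu : x = u := le_antisymm hx.2 hx'
    refine ⟨hxu, ?_⟩
    apply k3 ⟨hv.1.trans hy.1, hy.2⟩ hv
    rw [← hxy, hxu, hvu]
  have hsub : Icc s u ⊆ Icc s t := Icc_subset_Icc_right hu.2
  have hsub' : Icc v t' ⊆ Icc s' t' := Icc_subset_Icc_left hv.1
  have hm : MapsTo (fun x : ℝ => x - u + v) (Icc u (u + (t' - v))) (Icc v t') := by
    intro x hx
    simp only [mem_Icc] at hx ⊢
    constructor <;> linarith [hx.1, hx.2]
  set k : ℝ → ↥Disk := fun x => if x ≤ u then g x else h (x - u + v) with hk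
  have hkl : ∀ x, x ≤ u → k x = g x := fun x hx => by simp [hk, hx]
  have hkr : ∀ x, u ≤ x → k x = h (x - u + v) := by
    intro x hx
    rcases hx.eq_or_lt with rfl | hx
    · simp [hk, hvu]
    · simp [hk, not_le.2 hx]
  have hun : Icc s (u + (t' - v)) = Icc s u ∪ Icc u (u + (t' - v)) := by
    rw [Icc_union_Icc_eq_Icc hu.1]; linarith [hv.2]
  refine ⟨s, u + (t' - v), k, by linarith [hu.1, hv.2], ?_, ?_, ?_, ?_, ?_⟩
  · rw [hun]
    apply ContinuousOn.union_of_isClosed _ _ isClosed_Icc isClosed_Icc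
    · exact (h2.mono hsub).congr fun x hx => hkl x hx.2
    · refine ContinuousOn.congr (f := fun x => h (x - u + v)) ?_ fun x hx => hkr x hx.1
      exact (k2.mono hsub').comp (by fun_prop) hm
  · intro x hx y hy hxy
    rw [hun] at hx hy
    rcases hx with hx | hx <;> rcases hy with hy | hy
    · rw [hkl x hx.2, hkl y hy.2] at hxy
      exact h3 (hsub hx) (hsub hy) hxy
    · rw [hkl x hx.2, hkr y hy.1] at hxy
      have := hfirst x hx _ (hm hy) hxy
      linarith [this.1, this.2]
    · rw [hkr x hx.1, hkl y hy.2] at hxy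
      have := hfirst y hy _ (hm hx) hxy.symm
      linarith [this.1, this.2]
    · rw [hkr x hx.1, hkr y hy.1] at hxy
      have := k3 (hsub' (hm hx)) (hsub' (hm hy)) hxy
      linarith
  · rw [hkl s hu.1, h4]
  · rw [hkr _ (by linarith [hv.2])]
    rw [← k5]; congr 1; ring
  · intro x hx
    rw [hun] at hx
    rcases hx with hx | hx
    · rw [hkl x hx.2]; exact h6 (hsub hx)
    · rw [hkr x hx.1]; exact k6 (hsub' (hm hx))

theorem ArcIn.exists_isSegment {S : Set ↥Disk} {a b : ↥Disk} (hab : ArcIn S a b) (hne : a ≠ b) :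
    ∃ γ ⊆ S, IsSegment γ a b := by
  obtain ⟨s, t, g, h1, h2, h3, h4, h5, h6⟩ := hab
  have hst : s < t := by
    rcases h1.eq_or_lt with rfl | h
    · exact absurd (h4.symm.trans h5) hne
    · exact h
  have hm : MapsTo (fun x : ℝ => s + x * (t - s)) (Icc 0 1) (Icc s t) := by
    intro x hx
    simp only [mem_Icc] at hx ⊢
    constructor <;> nlinarith [hx.1, hx.2]
  refine ⟨(fun x => g (s + x * (t - s))) '' Icc 0 1, ?_, fun x => g (s + x * (t - s)), ?_, ?_,
    by simp [h4], by simp [h5], rfl⟩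
  · rintro _ ⟨x, hx, rfl⟩
    exact h6 (hm hx)
  · exact h2.comp (by fun_prop) hm
  · intro x hx y hy hxy
    have := h3 (hm hx) (hm hy) hxy
    have h : x * (t - s) = y * (t - s) := by linarith
    exact mul_right_cancel₀ (by linarith) h

/-- A straight segment is an arc. -/
theorem arcIn_line {S : Set ↥Disk} (a b : ↥Disk)
    (h : ∀ t ∈ Icc (0:ℝ) 1, ∃ w ∈ S, w.1 = a.1 + (t:ℂ) * (b.1 - a.1)) : ArcIn S a b := by
  by_cases hab : a = b
  · subst hab
    obtain ⟨w, hw, hw'⟩ := h 0 ⟨le_rfl, zero_le_one⟩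
    have : w = a := Subtype.ext (by simpa using hw')
    subst this
    exact ⟨0, 0, fun _ => w, le_rfl, continuousOn_const, by simp, rfl, rfl, fun _ _ => hw⟩
  choose! g hgS hg using h
  refine ⟨0, 1, g, zero_le_one, ?_, ?_, ?_, ?_, hgS⟩
  · rw [Topology.IsInducing.subtypeVal.continuousOn_iff]
    refine ContinuousOn.congr (f := fun t : ℝ => a.1 + (t:ℂ) * (b.1 - a.1)) ?_ hg
    fun_prop
  · intro x hx y hy hxy
    have h1 := hg x hx
    rw [hxy, hg y hy] at h1
    have h2 : (b.1 - a.1) ≠ 0 := sub_ne_zero.2 fun h => hab (Subtype.ext h.symm)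
    have h3 : (y:ℂ) = x := mul_right_cancel₀ h2 (add_left_cancel h1)
    exact_mod_cast h3.symm
  · exact Subtype.ext (by rw [hg 0 ⟨le_rfl, zero_le_one⟩]; simp)
  · exact Subtype.ext (by rw [hg 1 ⟨zero_le_one, le_rfl⟩]; simp)

/-! ### Grids -/

/-- Points with real part in `X` or imaginary part in `X`. -/
def Grid (X : Set ℝ) : Set ↥Disk := {w | w.1.re ∈ X ∨ w.1.im ∈ X}

theorem Grid.mono {X Y : Set ℝ} (h : X ⊆ Y) : Grid X ⊆ Grid Y :=
  fun _ hw => hw.imp (fun h' => h h') (fun h' => h h')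

/-- Joined by an arc in a finite part of the grid within `U`. -/
def GridRel (X : Set ℝ) (U : Set ↥Disk) (a b : ↥Disk) : Prop :=
  ∃ F : Set ℝ, F.Finite ∧ F ⊆ X ∧ ArcIn (Grid F ∩ U) a b

theorem GridRel.symm {X : Set ℝ} {U : Set ↥Disk} {a b : ↥Disk} (h : GridRel X U a b) :
    GridRel X U b a := by
  obtain ⟨F, h1, h2, h3⟩ := h
  exact ⟨F, h1, h2, h3.symm⟩

theorem GridRel.trans {X : Set ℝ} {U : Set ↥Disk} {a b c : ↥Disk} (h : GridRel X U a b)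
    (h' : GridRel X U b c) : GridRel X U a c := by
  obtain ⟨F, h1, h2, h3⟩ := h
  obtain ⟨F', h1', h2', h3'⟩ := h'
  refine ⟨F ∪ F', h1.union h1', union_subset h2 h2', ?_⟩
  exact (h3.mono (inter_subset_inter_left _ (Grid.mono subset_union_left))).trans
    (h3'.mono (inter_subset_inter_left _ (Grid.mono subset_union_right)))

/-- Open box around a point. -/
def Box (m : ↥Disk) (r : ℝ) : Set ℂ := {w | |w.re - m.1.re| < r ∧ |w.im - m.1.im| < r}

theorem exists_box {U : Set ↥Disk} (hU : IsOpen U) {m : ↥Disk} (hm : m ∈ U) :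
    ∃ r > 0, ∀ w ∈ Box m r, ∃ h : w ∈ Disk, (⟨w, h⟩ : ↥Disk) ∈ U := by
  obtain ⟨O, hO, rfl⟩ := isOpen_induced_iff.1 hU
  have hO' : IsOpen (O ∩ Disk) := hO.inter isOpen_ball
  obtain ⟨ε, hε, hb⟩ := Metric.isOpen_iff.1 hO' m.1 ⟨hm, m.2⟩
  refine ⟨ε / 2, by positivity, fun w hw => ?_⟩
  have : w ∈ ball m.1 ε := by
    rw [mem_ball, dist_eq_norm]
    refine (Complex.norm_le_abs_re_add_abs_im _).trans_lt ?_
    simp only [Complex.sub_re, Complex.sub_im]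
    linarith [hw.1, hw.2]
  exact ⟨(hb this).2, (hb this).1⟩

theorem box_nhds (m : ↥Disk) {r : ℝ} (hr : 0 < r) : {w : ↥Disk | w.1 ∈ Box m r} ∈ 𝓝 m := by
  have : IsOpen {w : ↥Disk | w.1 ∈ Box m r} := by
    apply IsOpen.and
    · exact isOpen_lt (by fun_prop) continuous_const
    · exact isOpen_lt (by fun_prop) continuous_const
  exact this.mem_nhds (by simp [Box, hr])

theorem abs_lerp {a b c r t : ℝ} (ha : |a - c| < r) (hb : |b - c| < r) (ht : t ∈ Icc (0:ℝ) 1) :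
    |a + t * (b - a) - c| < r := by
  have h1 := abs_lt.1 ha
  have h2 := abs_lt.1 hb
  obtain ⟨h3, h4⟩ := ht
  have e : a + t * (b - a) - c = (1 - t) * (a - c) + t * (b - c) := by ring
  rw [e, abs_lt]
  rcases h3.eq_or_lt with rfl | h3
  · simpa using h1
  · constructor <;> nlinarith

theorem dense_pick {X : Set ℝ} (hX : Dense X) (c : ℝ) {r : ℝ} (hr : 0 < r) :
    ∃ x ∈ X, |x - c| < r := by
  obtain ⟨x, hx, hx'⟩ := hX.exists_dist_lt c hr
  exact ⟨x, hx, by rwa [dist_comm, Real.dist_eq] at hx'⟩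

theorem gridRel_local {X : Set ℝ} (hX : Dense X) {U : Set ↥Disk} (hU : IsOpen U) {m : ↥Disk}
    (hm : m ∈ U) : ∃ W ∈ 𝓝 m, ∀ a ∈ W ∩ Grid X, ∀ b ∈ W ∩ Grid X, GridRel X U a b := by
  obtain ⟨r, hr, hbox⟩ := exists_box hU hm
  obtain ⟨x0, hx0, hx0'⟩ := dense_pick hX m.1.re hr
  obtain ⟨y0, hy0, hy0'⟩ := dense_pick hX m.1.im hr
  -- vertical and horizontal moves
  have key : ∀ a b : ↥Disk, a.1 ∈ Box m r → b.1 ∈ Box m r →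
      ((a.1.re = b.1.re ∧ a.1.re ∈ X) ∨ (a.1.im = b.1.im ∧ a.1.im ∈ X)) → GridRel X U a b := by
    intro a b ha hb hab
    have hw : ∀ t ∈ Icc (0:ℝ) 1, a.1 + (t:ℂ) * (b.1 - a.1) ∈ Box m r := by
      intro t ht
      constructor
      · simpa using abs_lerp ha.1 hb.1 ht
      · simpa using abs_lerp ha.2 hb.2 ht
    rcases hab with ⟨hab, haX⟩ | ⟨hab, haX⟩
    · refine ⟨{a.1.re}, finite_singleton _, by simpa using haX, arcIn_line a b fun t ht => ?_⟩
      obtain ⟨h1, h2⟩ := hbox _ (hw t ht)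
      exact ⟨⟨_, h1⟩, ⟨Or.inl (by simp [hab]), h2⟩, rfl⟩
    · refine ⟨{a.1.im}, finite_singleton _, by simpa using haX, arcIn_line a b fun t ht => ?_⟩
      obtain ⟨h1, h2⟩ := hbox _ (hw t ht)
      exact ⟨⟨_, h1⟩, ⟨Or.inr (by simp [hab]), h2⟩, rfl⟩
  have mk : ∀ x y : ℝ, |x - m.1.re| < r → |y - m.1.im| < r →
      ∃ w : ↥Disk, w.1 ∈ Box m r ∧ w.1.re = x ∧ w.1.im = y := by
    intro x y hx hy
    have hB : (⟨x, y⟩ : ℂ) ∈ Box m r := ⟨hx, hy⟩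
    obtain ⟨h1, _⟩ := hbox _ hB
    exact ⟨⟨_, h1⟩, hB, rfl, rfl⟩
  obtain ⟨c, hc, hcx, hcy⟩ := mk x0 y0 hx0' hy0'
  have toc : ∀ a ∈ {w : ↥Disk | w.1 ∈ Box m r} ∩ Grid X, GridRel X U a c := by
    rintro a ⟨ha, haX | haX⟩
    · obtain ⟨d, hd, hdx, hdy⟩ := mk a.1.re y0 ha.1 hy0'
      refine (key a d ha hd (Or.inl ⟨hdx.symm, haX⟩)).trans (key d c hd hc (Or.inr ⟨?_, ?_⟩))
      · rw [hdy, hcy]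
      · rwa [hdy]
    · obtain ⟨d, hd, hdx, hdy⟩ := mk x0 a.1.im hx0' ha.2
      refine (key a d ha hd (Or.inr ⟨hdy.symm, haX⟩)).trans (key d c hd hc (Or.inl ⟨?_, ?_⟩))
      · rw [hdx, hcx]
      · rwa [hdx]
  exact ⟨_, box_nhds m hr, fun a ha b hb => (toc a ha).trans (toc b hb).symm⟩

theorem grid_dense {X : Set ℝ} (hX : Dense X) {m : ↥Disk} {W : Set ↥Disk} (hW : W ∈ 𝓝 m) :
    (W ∩ Grid X).Nonempty := by
  obtain ⟨O, hOW, hO, hmO⟩ := _root_.mem_nhds_iff.1 hW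
  obtain ⟨r, hr, hbox⟩ := exists_box hO hmO
  obtain ⟨x0, hx0, hx0'⟩ := dense_pick hX m.1.re hr
  obtain ⟨h1, h2⟩ := hbox ⟨x0, m.1.im⟩ ⟨hx0', by simpa using hr⟩
  exact ⟨_, hOW h2, Or.inl hx0⟩

theorem gridRel_of_preconnected {X : Set ℝ} (hX : Dense X) {U M : Set ↥Disk} (hU : IsOpen U)
    (hM : IsPreconnected M) (hMU : M ⊆ U) {a b : ↥Disk} (ha : a ∈ M) (hb : b ∈ M)
    (haX : a ∈ Grid X) (hbX : b ∈ Grid X) : GridRel X U a b := by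
  have := hM.induction₂ (fun m m' => ∃ W ∈ 𝓝 m, ∃ W' ∈ 𝓝 m', ∀ a ∈ W ∩ Grid X,
      ∀ b ∈ W' ∩ Grid X, GridRel X U a b) ?_ ?_ ?_ ha hb
  · obtain ⟨W, hW, W', hW', h⟩ := this
    exact h a ⟨mem_of_mem_nhds hW, haX⟩ b ⟨mem_of_mem_nhds hW', hbX⟩
  · intro m hm
    obtain ⟨W, hW, h⟩ := gridRel_local hX hU (hMU hm)
    filter_upwards [mem_nhdsWithin_of_mem_nhds (eventually_mem_nhds_iff.2 hW)] with y hy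
    exact ⟨W, hW, W, hy, h⟩
  · rintro x y w hx hy hw ⟨W, hW, W', hW', h⟩ ⟨V, hV, V', hV', h'⟩
    refine ⟨W, hW, V', hV', fun a ha b hb => ?_⟩
    obtain ⟨c, hc, hc'⟩ := grid_dense hX (inter_mem hW' hV)
    exact (h a ha c ⟨hc.1, hc'⟩).trans (h' c ⟨hc.2, hc'⟩ b hb)
  · rintro x y hx hy ⟨W, hW, W', hW', h⟩
    exact ⟨W', hW', W, hW, fun a ha b hb => (h b hb a ha).symm⟩

theorem exists_grid_time {X : Set ℝ} (hX : Dense X) {g : ℝ → ↥Disk} {a b : ℝ} (hab : a < b)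
    (hg : ContinuousOn g (Icc a b)) (hi : InjOn g (Icc a b)) : ∃ t ∈ Icc a b, g t ∈ Grid X := by
  have hne : g a ≠ g b := fun h =>
    hab.ne (hi ⟨le_rfl, hab.le⟩ ⟨hab.le, le_rfl⟩ h)
  have main : ∀ φ : ℂ → ℝ, Continuous φ → φ (g a).1 ≠ φ (g b).1 →
      ∃ t ∈ Icc a b, φ (g t).1 ∈ X := by
    intro φ hφ h
    have hc : ContinuousOn (fun t => φ (g t).1) (uIcc a b) := by
      rw [uIcc_of_le hab.le]
      exact (hφ.comp continuous_subtype_val).comp_continuousOn hg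
    have hiv := intermediate_value_uIcc hc
    have hlt : min (φ (g a).1) (φ (g b).1) < max (φ (g a).1) (φ (g b).1) := by
      exact min_lt_max.2 h
    obtain ⟨x, hx, hx'⟩ := hX.exists_between hlt
    obtain ⟨t, ht, htx⟩ := hiv (show x ∈ uIcc _ _ from ⟨hx'.1.le, hx'.2.le⟩)
    rw [uIcc_of_le hab.le] at ht
    refine ⟨t, ht, ?_⟩
    have htx' : φ (g t).1 = x := htx
    rwa [htx']
  by_cases h : (g a).1.re = (g b).1.re
  · have h' : (g a).1.im ≠ (g b).1.im := fun h' => hne (Subtype.ext (Complex.ext h h'))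
    obtain ⟨t, ht, h⟩ := main _ Complex.continuous_im h'
    exact ⟨t, ht, Or.inr h⟩
  · obtain ⟨t, ht, h⟩ := main _ Complex.continuous_re h
    exact ⟨t, ht, Or.inl h⟩

/-! ### Perturbing one arc -/

theorem perturb_arc (f : ↥Disk ≃ₜ ↥Disk) {p q : ↥Disk} {γ : Set ↥Disk} (hpq : p ≠ q)
    (hfp : f p = q) (hγ : IsSegment γ p q) (hf : (⇑f '' γ) ∩ γ = {q}) {V Np Nq : Set ↥Disk}
    (hV : IsOpen V) (hγV : γ ⊆ V) (hNp : Np ∈ 𝓝 p) (hNq : Nq ∈ 𝓝 q) {X : Set ℝ}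
    (hX : Dense X) :
    ∃ γ' : Set ↥Disk, ∃ F : Set ℝ, IsSegment γ' p q ∧ F.Finite ∧ F ⊆ X ∧ γ' ⊆ V ∧
      γ' ⊆ Np ∪ Nq ∪ Grid F ∧ (⇑f '' γ') ∩ γ' = {q} := by
  obtain ⟨g, hgc, hgi, hg0, hg1, rfl⟩ := hγ
  have hγc : IsCompact (g '' Icc 0 1) := isCompact_Icc.image_of_continuousOn hgc
  -- the initial germ
  obtain ⟨a, ha0, ha1, haN⟩ : ∃ a : ℝ, 0 < a ∧ a < 1 / 2 ∧ ∀ t ∈ Icc 0 a, g t ∈ Np := by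
    have h := (hgc 0 (by simp)).tendsto
    rw [hg0] at h
    have h2 := h hNp
    rw [mem_map, mem_nhdsWithin_iff_exists_mem_nhds_inter] at h2
    obtain ⟨u, hu, hu'⟩ := h2
    obtain ⟨ε, hε, hb⟩ := Metric.mem_nhds_iff.1 hu
    refine ⟨min (ε / 2) (1 / 4), by positivity, ?_, fun t ht => ?_⟩
    · exact (min_le_right _ _).trans_lt (by norm_num)
    · have h3 := ht.2.trans (min_le_left _ _)
      have h4 := ht.2.trans (min_le_right _ _)
      refine hu' ⟨hb ?_, ht.1, by linarith⟩
      rw [mem_ball, Real.dist_eq, sub_zero, abs_of_nonneg ht.1]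
      linarith
  obtain ⟨b, hb0, hb1, hbN⟩ : ∃ b : ℝ, 1 / 2 < b ∧ b < 1 ∧ ∀ t ∈ Icc b 1, g t ∈ Nq := by
    have h := (hgc 1 (by simp)).tendsto
    rw [hg1] at h
    have h2 := h hNq
    rw [mem_map, mem_nhdsWithin_iff_exists_mem_nhds_inter] at h2
    obtain ⟨u, hu, hu'⟩ := h2
    obtain ⟨ε, hε, hb⟩ := Metric.mem_nhds_iff.1 hu
    refine ⟨1 - min (ε / 2) (1 / 4), ?_, ?_, fun t ht => ?_⟩
    · linarith [min_le_right (ε / 2) (1 / 4)]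
    · have : 0 < min (ε / 2) (1 / 4) := by positivity
      linarith
    · have h3 := min_le_left (ε / 2) (1 / 4)
      have h4 := min_le_right (ε / 2) (1 / 4)
      have h5 := ht.1
      refine hu' ⟨hb ?_, by linarith, ht.2⟩
      rw [mem_ball, Real.dist_eq, abs_sub_comm, abs_of_nonneg (by linarith [ht.2])]
      linarith
  have hs1 : Icc (a / 2) a ⊆ Icc 0 1 := Icc_subset_Icc (by linarith) (by linarith)
  have hs2 : Icc b ((1 + b) / 2) ⊆ Icc 0 1 := Icc_subset_Icc (by linarith) (by linarith)
  obtain ⟨t0, ht0, ht0X⟩ := exists_grid_time hX (by linarith) (hgc.mono hs1) (hgi.mono hs1)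
  obtain ⟨t1, ht1, ht1X⟩ := exists_grid_time hX (by linarith) (hgc.mono hs2) (hgi.mono hs2)
  obtain ⟨ht0l, ht0r⟩ := ht0
  obtain ⟨ht1l, ht1r⟩ := ht1
  have hs3 : Icc t0 t1 ⊆ Icc 0 1 := Icc_subset_Icc (by linarith) (by linarith)
  have hMc : IsCompact (g '' Icc t0 t1) := isCompact_Icc.image_of_continuousOn (hgc.mono hs3)
  have hMγ : g '' Icc t0 t1 ⊆ g '' Icc 0 1 := image_mono hs3
  have hpM : p ∉ g '' Icc t0 t1 := by
    rintro ⟨t, ht, h⟩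
    have := hgi (hs3 ht) (show (0:ℝ) ∈ Icc 0 1 by simp) (h.trans hg0.symm)
    linarith [ht.1]
  have hqM : q ∉ g '' Icc t0 t1 := by
    rintro ⟨t, ht, h⟩
    have := hgi (hs3 ht) (show (1:ℝ) ∈ Icc 0 1 by simp) (h.trans hg1.symm)
    linarith [ht.2]
  have hM1 : ∀ x ∈ g '' Icc t0 t1, x ∉ ⇑f '' (g '' Icc 0 1) := by
    intro x hx hx'
    have : x ∈ ({q} : Set ↥Disk) := hf ▸ ⟨hx', hMγ hx⟩
    rw [mem_singleton_iff] at this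
    exact hqM (this ▸ hx)
  have hM2 : ∀ x ∈ g '' Icc t0 t1, f x ∉ g '' Icc 0 1 := by
    intro x hx hx'
    have : f x ∈ ({q} : Set ↥Disk) := hf ▸ ⟨mem_image_of_mem _ (hMγ hx), hx'⟩
    rw [mem_singleton_iff, ← hfp] at this
    exact hpM (f.injective this ▸ hx)
  have hdis : Disjoint (g '' Icc t0 t1) (⇑f '' (g '' Icc t0 t1)) := by
    rw [Set.disjoint_left]
    intro x hx hx'
    exact hM1 x hx (image_mono hMγ hx')
  obtain ⟨A, B, hA, hB, hMA, hMB, hAB⟩ :=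
    SeparatedNhds.of_isCompact_isCompact hMc (hMc.image f.continuous) hdis
  set U : Set ↥Disk := A ∩ f ⁻¹' B ∩ V ∩ (⇑f '' (g '' Icc 0 1))ᶜ ∩ (⇑f ⁻¹' (g '' Icc 0 1))ᶜ
    with hUdef
  have hU : IsOpen U :=
    (((hA.inter (hB.preimage f.continuous)).inter hV).inter
      (hγc.image f.continuous).isClosed.isOpen_compl).inter
      (hγc.isClosed.preimage f.continuous).isOpen_compl
  have hMU : g '' Icc t0 t1 ⊆ U := fun x hx =>
    ⟨⟨⟨⟨hMA hx, hMB (mem_image_of_mem _ hx)⟩, hγV (hMγ hx)⟩, hM1 x hx⟩, hM2 x hx⟩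
  have hMp : IsPreconnected (g '' Icc t0 t1) := isPreconnected_Icc.image _ (hgc.mono hs3)
  have ht01 : t0 ≤ t1 := by linarith
  obtain ⟨F, hF, hFX, harc⟩ := gridRel_of_preconnected hX hU hMp hMU
    (mem_image_of_mem g ⟨le_rfl, ht01⟩) (mem_image_of_mem g ⟨ht01, le_rfl⟩) ht0X ht1X
  have hs4 : Icc 0 t0 ⊆ Icc 0 1 := Icc_subset_Icc (by linarith) (by linarith)
  have hs5 : Icc t1 1 ⊆ Icc 0 1 := Icc_subset_Icc (by linarith) (by linarith)
  have arc0 : ArcIn (g '' Icc 0 t0) p (g t0) :=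
    ⟨0, t0, g, by linarith, hgc.mono hs4, hgi.mono hs4, hg0, rfl, mapsTo_image _ _⟩
  have arc1 : ArcIn (g '' Icc t1 1) (g t1) q :=
    ⟨t1, 1, g, by linarith, hgc.mono hs5, hgi.mono hs5, rfl, hg1, mapsTo_image _ _⟩
  have arc : ArcIn (g '' Icc 0 t0 ∪ (Grid F ∩ U) ∪ g '' Icc t1 1) p q :=
    ((arc0.mono (subset_union_left.trans subset_union_left)).trans
      (harc.mono (subset_union_right.trans subset_union_left))).trans
      (arc1.mono subset_union_right)
  obtain ⟨γ', hγ'S, hγ'⟩ := arc.exists_isSegment hpq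
  have hsub : γ' ⊆ g '' Icc 0 1 ∪ U := by
    intro x hx
    rcases hγ'S hx with (h | h) | h
    · exact Or.inl (image_mono hs4 h)
    · exact Or.inr h.2
    · exact Or.inl (image_mono hs5 h)
  refine ⟨γ', F, hγ', hF, hFX, ?_, ?_, ?_⟩
  · intro x hx
    rcases hsub hx with h | h
    · exact hγV h
    · exact h.1.1.2
  · intro x hx
    rcases hγ'S hx with (⟨t, ht, rfl⟩ | h) | ⟨t, ht, rfl⟩
    · exact Or.inl (Or.inl (haN t ⟨ht.1, ht.2.trans ht0r⟩))
    · exact Or.inr h.1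
    · exact Or.inl (Or.inr (hbN t ⟨ht1l.trans ht.1, ht.2⟩))
  · have hp' : p ∈ γ' := by
      obtain ⟨h, -, -, h0, -, rfl⟩ := hγ'
      exact ⟨0, by simp, h0⟩
    have hq' : q ∈ γ' := by
      obtain ⟨h, -, -, -, h1, rfl⟩ := hγ'
      exact ⟨1, by simp, h1⟩
    apply Subset.antisymm
    · rintro _ ⟨⟨y, hy, rfl⟩, hx⟩
      rcases hsub hy with hy | hy <;> rcases hsub hx with hx | hx
      · exact hf ▸ ⟨mem_image_of_mem _ hy, hx⟩
      · exact absurd (mem_image_of_mem _ hy) hx.1.2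
      · exact absurd hx hy.2
      · exact absurd hy.1.1.1.2 (Set.disjoint_left.1 hAB hx.1.1.1.1)
    · rw [singleton_subset_iff]
      exact ⟨⟨p, hp', hfp⟩, hq'⟩

/-! ### Separating neighbourhoods of a locally finite family of compact sets -/

theorem exists_separating {ι : Type*} (A : ι → Set ↥Disk) (hc : ∀ i, IsCompact (A i))
    (hl : LocallyFinite A) : ∃ V : ι → Set ↥Disk, (∀ i, IsOpen (V i)) ∧ (∀ i, A i ⊆ V i) ∧
      ∀ i j, Disjoint (A i) (A j) → Disjoint (V i) (V j) := by
  have h : ∀ i, ∃ δ : ℝ, 0 < δ ∧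
      Disjoint (thickening δ (A i)) (thickening δ (⋃ j : {j // Disjoint (A i) (A j)}, A j)) := by
    intro i
    apply Disjoint.exists_thickenings _ (hc i)
    · apply LocallyFinite.isClosed_iUnion (hl.comp_injective Subtype.val_injective)
      exact fun j => (hc _).isClosed
    · rw [disjoint_iUnion_right]
      exact fun j => j.2
  choose δ hδ hd using h
  have main : ∀ i j, δ j ≤ δ i → Disjoint (A i) (A j) →
      Disjoint (thickening (δ i) (A i)) (thickening (δ j) (A j)) := by
    intro i j hij hdis
    refine (hd i).mono_right ?_
    refine (thickening_mono hij _).trans (thickening_subset_of_subset _ ?_)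
    exact subset_iUnion (fun j : {j // Disjoint (A i) (A j)} => A j) ⟨j, hdis⟩
  refine ⟨fun i => thickening (δ i) (A i), fun i => isOpen_thickening,
    fun i => self_subset_thickening (hδ i) _, fun i j hij => ?_⟩
  rcases le_total (δ j) (δ i) with h | h
  · exact main i j h hij
  · exact (main j i h hij.symm).symm

/-! ### Disjoint dense sets of reals -/

theorem exists_dense_family (J : Type) [Countable J] (D : Set ℝ) (hD : D.Countable) :
    ∃ X : J → Set ℝ, (∀ j, Dense (X j)) ∧ (∀ j, Disjoint (X j) D) ∧
      ∀ j j', j ≠ j' → Disjoint (X j) (X j') := by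
  let H : AddSubgroup ℝ := (Rat.castHom ℝ).toAddMonoidHom.range
  let π : ℝ → ℝ ⧸ H := QuotientAddGroup.mk
  have hfib : ∀ c, (π ⁻¹' {c}).Countable := by
    intro c
    obtain ⟨x, rfl⟩ := QuotientAddGroup.mk_surjective c
    refine (countable_range (fun q : ℚ => x + (q:ℝ))).mono ?_
    intro y hy
    have hy' : (QuotientAddGroup.mk x : ℝ ⧸ H) = QuotientAddGroup.mk y := hy.symm
    rw [QuotientAddGroup.eq] at hy'
    obtain ⟨q, hq⟩ := hy'
    refine ⟨q, ?_⟩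
    have hq' : (q:ℝ) = -x + y := hq
    simp only [hq']; ring
  have hinf : ((π '' D)ᶜ : Set (ℝ ⧸ H)).Infinite := by
    intro hfin
    have hcount : (univ : Set (ℝ ⧸ H)).Countable := by
      rw [← union_compl_self (π '' D)]
      exact (hD.image π).union hfin.countable
    have : (univ : Set ℝ).Countable := by
      have h2 : (univ : Set ℝ) = ⋃ c ∈ (univ : Set (ℝ ⧸ H)), π ⁻¹' {c} := by
        ext x; simp
      rw [h2]
      exact hcount.biUnion fun c _ => hfib c
    exact Cardinal.not_countable_real this
  obtain ⟨e, he⟩ := exists_injective_nat J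
  let c : J → ℝ ⧸ H := fun j => (hinf.natEmbedding _ (e j)).1
  have hc : Function.Injective c := fun a b h =>
    he ((hinf.natEmbedding _).injective (Subtype.ext h))
  have hcD : ∀ j, c j ∉ π '' D := fun j => (hinf.natEmbedding _ (e j)).2
  refine ⟨fun j => π ⁻¹' {c j}, fun j => ?_, fun j => ?_, fun j j' hjj => ?_⟩
  · obtain ⟨x, hx⟩ := QuotientAddGroup.mk_surjective (c j)
    have hr : DenseRange (fun q : ℚ => x + (q:ℝ)) :=
      (Homeomorph.addLeft x).surjective.denseRange.comp Rat.denseRange_cast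
        (Homeomorph.addLeft x).continuous
    refine Dense.mono ?_ hr
    rintro _ ⟨q, rfl⟩
    change (QuotientAddGroup.mk (x + (q:ℝ)) : ℝ ⧸ H) = c j
    rw [← hx, eq_comm, QuotientAddGroup.eq]
    exact ⟨q, by simp⟩
  · rw [Set.disjoint_left]
    intro x hx hxD
    exact hcD j ⟨x, hxD, hx⟩
  · rw [Set.disjoint_left]
    intro x hx hx'
    exact hjj (hc (hx.symm.trans hx'))

/-! ### The families of arcs -/

/-- The properties of the given family of arcs. -/
def GoodFam (f : ↥Disk ≃ₜ ↥Disk) {n : ℕ} (z : ZMod n → ↥Disk) (α ω : ZMod n → ℂ)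
    (γ : ZMod n → ℤ → Set ↥Disk) : Prop :=
  (∀ i k, IsTranslationArc f (fiter f k (z i)) (γ i k)) ∧
  (∀ i, ∀ k k' : ℤ, k' < k → (⇑f '' γ i k) ∩ γ i k' = ∅) ∧
  (∀ i, TendstoSetsBot (γ i) (α i)) ∧ (∀ i, TendstoSetsTop (γ i) (ω i))

theorem f_fiter (f : ↥Disk ≃ₜ ↥Disk) (k : ℤ) (w : ↥Disk) :
    f (fiter f k w) = fiter f (k + 1) w := by
  simp only [fiter]
  rw [add_comm, zpow_add, zpow_one]
  rfl

theorem fiter_add (f : ↥Disk ≃ₜ ↥Disk) (k l : ℤ) (w : ↥Disk) :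
    fiter f (k + l) w = fiter f k (fiter f l w) := by
  simp only [fiter]
  rw [zpow_add]
  rfl

theorem fiter_zero (f : ↥Disk ≃ₜ ↥Disk) (w : ↥Disk) : fiter f 0 w = w := by
  simp [fiter]

theorem fiter_injective (f : ↥Disk ≃ₜ ↥Disk) {n : ℕ} (z : ZMod n → ↥Disk) (α ω : ZMod n → ℂ)
    (hαinj : Function.Injective α) (hαω : ∀ i j, α i ≠ ω j)
    (hlimₘ : ∀ i, Tendsto (fun k : ℤ => (fiter f k (z i)).1) atBot (nhds (α i)))
    (hlimₚ : ∀ i, Tendsto (fun k : ℤ => (fiter f k (z i)).1) atTop (nhds (ω i)))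
    {i i' : ZMod n} {k k' : ℤ} (h : fiter f k (z i) = fiter f k' (z i')) : i = i' ∧ k = k' := by
  have hshift : ∀ m : ℤ, fiter f (m + k) (z i) = fiter f (m + k') (z i') := by
    intro m
    rw [fiter_add, fiter_add, h]
  have hi : i = i' := by
    apply hαinj
    have h1 := (hlimₘ i).comp (tendsto_atBot_add_const_right atBot k tendsto_id)
    have h2 := (hlimₘ i').comp (tendsto_atBot_add_const_right atBot k' tendsto_id)
    refine tendsto_nhds_unique h1 (h2.congr fun m => ?_)
    simp [hshift m]
  subst hi
  refine ⟨rfl, ?_⟩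
  have per : ∀ d : ℤ, 0 < d → (∀ m, fiter f (m + d) (z i) = fiter f m (z i)) → False := by
    intro d hd hper
    have hmul : ∀ m : ℕ, fiter f ((m:ℤ) * d) (z i) = z i := by
      intro m
      induction m with
      | zero => simp [fiter_zero]
      | succ m ih => push_cast; rw [add_mul, one_mul, hper, ih]
    have hmul' : ∀ m : ℕ, fiter f (-((m:ℤ) * d)) (z i) = z i := by
      intro m
      have := fiter_add f (-((m:ℤ) * d)) ((m:ℤ) * d) (z i)
      rw [hmul, neg_add_cancel, fiter_zero] at this
      exact this.symm
    have ht : Tendsto (fun m : ℕ => (m:ℤ) * d) atTop atTop :=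
      tendsto_atTop_mono (fun m : ℕ => le_mul_of_one_le_right (Int.natCast_nonneg m) hd)
        tendsto_natCast_atTop_atTop
    have h1 := (hlimₚ i).comp ht
    have h2 := (hlimₘ i).comp (tendsto_neg_atTop_atBot.comp ht)
    apply hαω i i
    refine tendsto_nhds_unique h2 (h1.congr fun m => ?_)
    simp [hmul m, hmul' m]
  rcases lt_trichotomy k k' with hk | hk | hk
  · exfalso
    refine per (k' - k) (by omega) fun m => ?_
    have := hshift (m - k)
    rw [sub_add_cancel] at this
    rw [this]; congr 1; ring
  · exact hk
  · exfalso
    refine per (k - k') (by omega) fun m => ?_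
    have := hshift (m - k')
    rw [sub_add_cancel] at this
    rw [← this]; congr 1; ring

theorem isSegment_compact {γ : Set ↥Disk} {a b : ↥Disk} (h : IsSegment γ a b) :
    IsCompact γ ∧ a ∈ γ ∧ b ∈ γ := by
  obtain ⟨g, h1, h2, h3, h4, rfl⟩ := h
  exact ⟨isCompact_Icc.image_of_continuousOn h1, ⟨0, by simp, h3⟩, ⟨1, by simp, h4⟩⟩

theorem goodFam_locallyFinite (n : ℕ) [NeZero n] (α ω : ZMod n → ℂ)
    (hα : ∀ i, α i ∈ Metric.sphere (0:ℂ) 1) (hω : ∀ i, ω i ∈ Metric.sphere (0:ℂ) 1)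
    (γ : ZMod n → ℤ → Set ↥Disk) (h3 : ∀ i, TendstoSetsBot (γ i) (α i))
    (h4 : ∀ i, TendstoSetsTop (γ i) (ω i)) :
    LocallyFinite (fun j : ZMod n × ℤ => γ j.1 j.2) := by
  intro x
  have hx : ‖x.1‖ < 1 := mem_ball_zero_iff.1 x.2
  set ε := (1 - ‖x.1‖) / 2 with hε
  have hε0 : 0 < ε := by rw [hε]; linarith
  choose N hN using fun i => h3 i ε hε0
  choose N' hN' using fun i => h4 i ε hε0
  refine ⟨ball x ε, ball_mem_nhds _ hε0, ?_⟩
  have far : ∀ c ∈ sphere (0:ℂ) 1, ∀ y ∈ ball x ε, ¬ dist y.1 c < ε := by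
    intro c hc y hy hyc
    have hy' : dist y.1 x.1 < ε := hy
    have h1 : ‖c‖ = 1 := by simpa using hc
    have h2 : dist x.1 c < 2 * ε := by
      have := dist_triangle_left x.1 c y.1
      linarith
    rw [dist_comm, dist_eq_norm] at h2
    have := norm_sub_norm_le c x.1
    rw [hε] at h2
    linarith
  refine ((finite_univ (α := ZMod n)).biUnion (t := fun i => (fun k => (i, k)) '' Icc (N i) (N' i))
    fun i _ => (finite_Icc _ _).image _).subset ?_
  rintro ⟨i, k⟩ ⟨y, hy, hyb⟩
  simp only [mem_univ, iUnion_true, mem_iUnion]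
  refine ⟨i, k, ⟨?_, ?_⟩, rfl⟩
  · by_contra hk
    exact far _ (hα i) y hyb (hN i k (by omega) y hy)
  · by_contra hk
    exact far _ (hω i) y hyb (hN' i k (by omega) y hy)

theorem perturb_family (f : ↥Disk ≃ₜ ↥Disk) (n : ℕ) [NeZero n]
    (z : ZMod n → ↥Disk) (α ω : ZMod n → ℂ)
    (hα : ∀ i, α i ∈ Metric.sphere (0:ℂ) 1) (hω : ∀ i, ω i ∈ Metric.sphere (0:ℂ) 1)
    (hinj : ∀ {i i' : ZMod n} {k k' : ℤ}, fiter f k (z i) = fiter f k' (z i') → i = i' ∧ k = k')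
    (γ : ZMod n → ℤ → Set ↥Disk) (hγ : GoodFam f z α ω γ)
    (X : ZMod n × ℤ → Set ℝ) (hX : ∀ j, Dense (X j)) :
    ∃ γ' : ZMod n → ℤ → Set ↥Disk, ∃ V N : ZMod n × ℤ → Set ↥Disk, ∃ F : ZMod n × ℤ → Set ℝ,
      GoodFam f z α ω γ' ∧ (∀ j, (F j).Finite) ∧ (∀ j, F j ⊆ X j) ∧
      (∀ i k, γ' i k ⊆ V (i, k)) ∧
      (∀ i k, γ' i k ⊆ N (i, k) ∪ N (i, k + 1) ∪ Grid (F (i, k))) ∧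
      (∀ i k, fiter f k (z i) ∈ N (i, k)) ∧
      (∀ j l, j ≠ l → Disjoint (N j) (N l)) ∧
      (∀ i k l, fiter f k (z i) ∉ γ l.1 l.2 → Disjoint (N (i, k)) (V l)) := by
  obtain ⟨h1, h2, h3, h4⟩ := hγ
  have hseg : ∀ i k, IsSegment (γ i k) (fiter f k (z i)) (fiter f (k + 1) (z i)) := by
    intro i k
    rw [← f_fiter]
    exact (h1 i k).2.1
  have hne : ∀ i k, fiter f k (z i) ≠ fiter f (k + 1) (z i) := by
    intro i k h
    have := (hinj h).2
    omega
  have hne2 : ∀ i k, f (f (fiter f k (z i))) ≠ fiter f k (z i) := by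
    intro i k h
    rw [f_fiter, f_fiter] at h
    have := (hinj h).2
    omega
  have hlf := goodFam_locallyFinite n α ω hα hω γ h3 h4
  let A1 : ZMod n × ℤ → Set ↥Disk := fun j => γ j.1 j.2
  let A2 : ZMod n × ℤ → Set ↥Disk := fun j => ⇑f '' γ j.1 j.2
  let A3 : ZMod n × ℤ → Set ↥Disk := fun j => {fiter f j.2 (z j.1)}
  have hlf2 : LocallyFinite A2 := by
    have := hlf.preimage_continuous f.symm.continuous
    refine this.subset fun j => ?_
    rintro _ ⟨x, hx, rfl⟩
    simpa using hx
  have hlf3 : LocallyFinite A3 := by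
    refine hlf.subset fun j => ?_
    exact singleton_subset_iff.2 (isSegment_compact (hseg j.1 j.2)).2.1
  have hc1 : ∀ j, IsCompact (A1 j) := fun j => (isSegment_compact (hseg j.1 j.2)).1
  obtain ⟨W, hWo, hAW, hWd⟩ := exists_separating (Sum.elim A1 (Sum.elim A2 A3))
    (by
      rintro (j | j | j)
      · exact hc1 j
      · exact (hc1 j).image f.continuous
      · exact isCompact_singleton)
    (hlf.sumElim (hlf2.sumElim hlf3))
  let V : ZMod n × ℤ → Set ↥Disk := fun j =>
    W (Sum.inl j) ∩ f ⁻¹' (W (Sum.inr (Sum.inl j))) ∩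
      thickening (1 / ((|j.2| : ℤ) + 1 : ℝ)) (A1 j)
  let N : ZMod n × ℤ → Set ↥Disk := fun j => W (Sum.inr (Sum.inr j))
  have hpos : ∀ k : ℤ, 0 < 1 / ((|k| : ℤ) + 1 : ℝ) := by
    intro k
    have : (0:ℝ) ≤ ((|k| : ℤ) : ℝ) := by exact_mod_cast abs_nonneg k
    positivity
  have hVo : ∀ j, IsOpen (V j) := fun j =>
    ((hWo _).inter ((hWo _).preimage f.continuous)).inter isOpen_thickening
  have hAV : ∀ j, A1 j ⊆ V j := fun j x hx =>
    ⟨⟨hAW (Sum.inl j) hx, hAW (Sum.inr (Sum.inl j)) (mem_image_of_mem _ hx)⟩,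
      self_subset_thickening (hpos _) _ hx⟩
  have hN : ∀ i k, fiter f k (z i) ∈ N (i, k) := fun i k =>
    hAW (Sum.inr (Sum.inr (i, k))) (mem_singleton _)
  have hNn : ∀ i k, N (i, k) ∈ 𝓝 (fiter f k (z i)) := fun i k =>
    (hWo (Sum.inr (Sum.inr (i, k)))).mem_nhds (hN i k)
  have hpert := fun i k => perturb_arc f (hne i k) (f_fiter f k (z i)) (hseg i k)
    (by rw [← f_fiter]; exact (h1 i k).2.2.2 (hne2 i k)) (hVo (i, k)) (hAV (i, k)) (hNn i k)
    (hNn i (k + 1)) (hX (i, k))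
  choose γ' F g1 g2 g3 g4 g5 g6 using hpert
  have hclose : ∀ i k, ∀ x ∈ γ' i k, ∃ y ∈ γ i k, dist x.1 y.1 < 1 / ((|k| : ℤ) + 1 : ℝ) := by
    intro i k x hx
    exact mem_thickening_iff.1 (g4 i k hx).2
  have hsmall : ∀ ε : ℝ, 0 < ε → ∃ M : ℤ, 0 ≤ M ∧ ∀ k : ℤ, M ≤ |k| →
      1 / ((|k| : ℤ) + 1 : ℝ) < ε := by
    intro ε hε
    obtain ⟨m, hm⟩ := exists_nat_one_div_lt hε
    refine ⟨m, by positivity, fun k hk => lt_of_le_of_lt ?_ hm⟩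
    have : (m:ℝ) ≤ ((|k| : ℤ) : ℝ) := by exact_mod_cast hk
    gcongr
  refine ⟨γ', V, N, fun j => F j.1 j.2, ⟨?_, ?_, ?_, ?_⟩, fun j => g2 _ _, fun j => g3 _ _,
    g4, g5, hN, ?_, ?_⟩
  · intro i k
    refine ⟨?_, ?_, fun h => absurd h (hne2 i k), fun _ => ?_⟩
    · rw [f_fiter]; exact (hne i k).symm
    · rw [f_fiter]; exact g1 i k
    · rw [f_fiter]; exact g6 i k
  · intro i k k' hk
    have hd : Disjoint (A2 (i, k)) (A1 (i, k')) :=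
      Set.disjoint_iff_inter_eq_empty.2 (h2 i k k' hk)
    have hd' := hWd (Sum.inr (Sum.inl (i, k))) (Sum.inl (i, k')) hd
    rw [← Set.disjoint_iff_inter_eq_empty]
    refine hd'.mono ?_ ?_
    · rintro _ ⟨x, hx, rfl⟩
      exact (g4 i k hx).1.2
    · exact fun x hx => (g4 i k' hx).1.1
  · intro i ε hε
    obtain ⟨M, hM0, hM⟩ := hsmall (ε / 2) (by positivity)
    obtain ⟨K, hK⟩ := h3 i (ε / 2) (by positivity)
    refine ⟨min K (-M), fun k hk x hx => ?_⟩
    obtain ⟨y, hy, hxy⟩ := hclose i k x hx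
    have e1 := hK k (hk.trans (min_le_left _ _)) y hy
    have e2 := hM k (by have := hk.trans (min_le_right _ _); have := neg_le_abs k; omega)
    have := dist_triangle x.1 y.1 (α i)
    linarith
  · intro i ε hε
    obtain ⟨M, hM0, hM⟩ := hsmall (ε / 2) (by positivity)
    obtain ⟨K, hK⟩ := h4 i (ε / 2) (by positivity)
    refine ⟨max K M, fun k hk x hx => ?_⟩
    obtain ⟨y, hy, hxy⟩ := hclose i k x hx
    have e1 := hK k ((le_max_left _ _).trans hk) y hy
    have e2 := hM k (((le_max_right _ _).trans hk).trans (le_abs_self k))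
    have := dist_triangle x.1 y.1 (ω i)
    linarith
  · intro j l hjl
    apply hWd
    change Disjoint ({fiter f j.2 (z j.1)} : Set ↥Disk) {fiter f l.2 (z l.1)}
    rw [disjoint_singleton]
    intro h
    exact hjl (Prod.ext (hinj h).1 (hinj h).2)
  · intro i k l h
    have hd := hWd (Sum.inr (Sum.inr (i, k))) (Sum.inl l)
      (disjoint_singleton_left.2 h)
    exact hd.mono_right fun x hx => hx.1.1

theorem finite_reProdIm {S T : Set ℝ} (hS : S.Finite) (hT : T.Finite) : (S ×ℂ T).Finite := by
  refine ((hS.prod hT).image (fun p : ℝ × ℝ => (⟨p.1, p.2⟩ : ℂ))).subset ?_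
  intro w hw
  exact ⟨(w.re, w.im), ⟨hw.1, hw.2⟩, rfl⟩

/-- Proposition 4.1. -/
theorem handel_prop_4_1 (f : ↥Disk ≃ₜ ↥Disk) (n : ℕ) (hn : 1 ≤ n)
    (z : ZMod n → ↥Disk) (α ω : ZMod n → ℂ)
    (hα : ∀ i, α i ∈ Metric.sphere (0:ℂ) 1) (hω : ∀ i, ω i ∈ Metric.sphere (0:ℂ) 1)
    (hαinj : Function.Injective α) (hωinj : Function.Injective ω)
    (hαω : ∀ i j, α i ≠ ω j)
    (hlimₘ : ∀ i, Tendsto (fun k : ℤ => (fiter f k (z i)).1) atBot (nhds (α i)))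
    (hlimₚ : ∀ i, Tendsto (fun k : ℤ => (fiter f k (z i)).1) atTop (nhds (ω i)))
    (γ : ZMod n → ℤ → Set ↥Disk)
    (harc : ∀ i k, IsTranslationArc f (fiter f k (z i)) (γ i k))
    (hpast : ∀ i, ∀ k k' : ℤ, k' < k → (⇑f '' γ i k) ∩ γ i k' = ∅)
    (hconvₘ : ∀ i, TendstoSetsBot (γ i) (α i))
    (hconvₚ : ∀ i, TendstoSetsTop (γ i) (ω i)) :
    ∃ γ' : ZMod n → ℤ → Set ↥Disk,
      (∀ i k, IsTranslationArc f (fiter f k (z i)) (γ' i k)) ∧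
      (∀ i, ∀ k k' : ℤ, k' < k → (⇑f '' γ' i k) ∩ γ' i k' = ∅) ∧
      (∀ i, TendstoSetsBot (γ' i) (α i)) ∧
      (∀ i, TendstoSetsTop (γ' i) (ω i)) ∧
      (∀ i k, γ' i k ∩ orbitSet f (z i) = {fiter f k (z i), fiter f (k + 1) (z i)}) ∧
      (∀ i i' k, i' ≠ i → γ' i k ∩ orbitSet f (z i') = ∅) ∧
      (∀ i k i' k', ((i', k') : ZMod n × ℤ) ≠ (i, k - 1) →
        ((i', k') : ZMod n × ℤ) ≠ (i, k) → ((i', k') : ZMod n × ℤ) ≠ (i, k + 1) →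
        (γ' i k ∩ γ' i' k').Finite) ∧
      (∀ i k i' k' i'' k'', ((i, k) : ZMod n × ℤ) ≠ (i', k') →
        ((i, k) : ZMod n × ℤ) ≠ (i'', k'') → ((i', k') : ZMod n × ℤ) ≠ (i'', k'') →
        γ' i k ∩ γ' i' k' ∩ γ' i'' k'' = ∅) := by
  have : NeZero n := ⟨by omega⟩
  have hinj : ∀ {i i' : ZMod n} {k k' : ℤ}, fiter f k (z i) = fiter f k' (z i') →
      i = i' ∧ k = k' := fun h => fiter_injective f z α ω hαinj hαω hlimₘ hlimₚ h
  obtain ⟨X, hXd, hXD, hXX⟩ := exists_dense_family (ZMod n × ℤ)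
    (range (fun j : ZMod n × ℤ => (fiter f j.2 (z j.1)).1.re) ∪
      range (fun j : ZMod n × ℤ => (fiter f j.2 (z j.1)).1.im))
    ((countable_range _).union (countable_range _))
  have hXg : ∀ i k j (F : Set ℝ), F ⊆ X j → fiter f k (z i) ∉ Grid F := by
    intro i k j F hF h
    rcases h with h | h
    · exact Set.disjoint_left.1 (hXD j) (hF h) (Or.inl ⟨(i, k), rfl⟩)
    · exact Set.disjoint_left.1 (hXD j) (hF h) (Or.inr ⟨(i, k), rfl⟩)
  obtain ⟨γ₁, V₁, N₁, F₁, a1, -, a3, -, a5, a6, a7, -⟩ :=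
    perturb_family f n z α ω hα hω hinj γ ⟨harc, hpast, hconvₘ, hconvₚ⟩ X hXd
  obtain ⟨γ', V, N, F, b1, b2, b3, b4, b5, b6, b7, b8⟩ :=
    perturb_family f n z α ω hα hω hinj γ₁ a1 X hXd
  -- an orbit point on an arc is one of the two end points
  have clean : ∀ (δ : ZMod n → ℤ → Set ↥Disk) (N : ZMod n × ℤ → Set ↥Disk)
      (F : ZMod n × ℤ → Set ℝ), (∀ j, F j ⊆ X j) →
      (∀ i k, δ i k ⊆ N (i, k) ∪ N (i, k + 1) ∪ Grid (F (i, k))) →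
      (∀ i k, fiter f k (z i) ∈ N (i, k)) → (∀ j l, j ≠ l → Disjoint (N j) (N l)) →
      ∀ i k i' k', fiter f k' (z i') ∈ δ i k → i' = i ∧ (k' = k ∨ k' = k + 1) := by
    intro δ N F c3 c5 c6 c7 i k i' k' h
    have inN : ∀ l, fiter f k' (z i') ∈ N l → l = (i', k') := by
      intro l hl
      by_contra hne
      exact Set.disjoint_left.1 (c7 _ _ hne) hl (c6 i' k')
    rcases c5 i k h with (h | h) | h
    · have := inN _ h
      simp only [Prod.mk.injEq] at this
      exact ⟨this.1.symm, Or.inl this.2.symm⟩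
    · have := inN _ h
      simp only [Prod.mk.injEq] at this
      exact ⟨this.1.symm, Or.inr this.2.symm⟩
    · exact absurd h (hXg i' k' _ _ (c3 _))
  have clean₁ := clean γ₁ N₁ F₁ a3 a5 a6 a7
  have clean' := clean γ' N F b3 b5 b6 b7
  have hNV : ∀ i k j (x : ↥Disk), x ∈ N (i, k) → x ∈ V j →
      j = (i, k) ∨ j = (i, k - 1) := by
    intro i k j x hx hxV
    by_contra hcon
    refine Set.disjoint_left.1 (b8 i k j fun hmem => hcon ?_) hx hxV
    obtain ⟨e1, e2⟩ := clean₁ j.1 j.2 i k hmem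
    rcases e2 with e2 | e2
    · exact Or.inl (Prod.ext e1.symm e2.symm)
    · exact Or.inr (Prod.ext e1.symm (by simp only; omega))
  have hFF : ∀ j j' : ZMod n × ℤ, j ≠ j' → ∀ t, t ∈ F j → t ∈ F j' → False := by
    intro j j' hne t h h'
    exact Set.disjoint_left.1 (hXX j j' hne) (b3 j h) (b3 j' h')
  obtain ⟨d1, d2, d3, d4⟩ := b1
  have hends : ∀ i k, fiter f k (z i) ∈ γ' i k ∧ fiter f (k + 1) (z i) ∈ γ' i k := by
    intro i k
    have := (isSegment_compact (d1 i k).2.1).2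
    rwa [f_fiter] at this
  refine ⟨γ', d1, d2, d3, d4, ?_, ?_, ?_, ?_⟩
  · intro i k
    apply Subset.antisymm
    · rintro _ ⟨hx, m, rfl⟩
      rcases (clean' i k i m hx).2 with rfl | rfl
      · exact Or.inl rfl
      · exact Or.inr rfl
    · rintro x (rfl | rfl)
      · exact ⟨(hends i k).1, k, rfl⟩
      · exact ⟨(hends i k).2, k + 1, rfl⟩
  · intro i i' k hne
    rw [eq_empty_iff_forall_notMem]
    rintro _ ⟨hx, m, rfl⟩
    exact hne (clean' i k i' m hx).1
  · intro i k i' k' n1 n2 n3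
    have hfin : (Subtype.val ⁻¹' ((F (i, k)) ×ℂ (F (i', k')) ∪
        (F (i', k')) ×ℂ (F (i, k))) : Set ↥Disk).Finite := by
      apply Finite.preimage Subtype.val_injective.injOn
      exact (finite_reProdIm (b2 _) (b2 _)).union (finite_reProdIm (b2 _) (b2 _))
    refine hfin.subset ?_
    rintro x ⟨hx, hx'⟩
    have hg : ∀ i k i' k', ((i', k') : ZMod n × ℤ) ≠ (i, k - 1) →
        ((i', k') : ZMod n × ℤ) ≠ (i, k) → ((i', k') : ZMod n × ℤ) ≠ (i, k + 1) →
        x ∈ γ' i k → x ∈ γ' i' k' → x ∈ Grid (F (i, k)) := by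
      intro i k i' k' n1 n2 n3 hx hx'
      rcases b5 i k hx with (h | h) | h
      · rcases hNV _ _ _ _ h (b4 _ _ hx') with e | e
        · exact absurd e n2
        · exact absurd e n1
      · rcases hNV _ _ _ _ h (b4 _ _ hx') with e | e
        · exact absurd e n3
        · rw [add_sub_cancel_right] at e
          exact absurd e n2
      · exact h
    have hne : ((i, k) : ZMod n × ℤ) ≠ (i', k') := n2.symm
    have e1 := hg i k i' k' n1 n2 n3 hx hx'
    have e2 := hg i' k' i k
      (by intro h; simp only [Prod.mk.injEq] at h; exact n3 (Prod.ext h.1.symm (by simp only; omega)))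
      hne
      (by intro h; simp only [Prod.mk.injEq] at h; exact n1 (Prod.ext h.1.symm (by simp only; omega)))
      hx' hx
    rcases e1 with e1 | e1 <;> rcases e2 with e2 | e2
    · exact (hFF _ _ hne _ e1 e2).elim
    · exact Or.inl ⟨e1, e2⟩
    · exact Or.inr ⟨e2, e1⟩
    · exact (hFF _ _ hne _ e1 e2).elim
  · intro i k i' k' i'' k'' n1 n2 n3
    rw [eq_empty_iff_forall_notMem]
    rintro x ⟨⟨hx, hx'⟩, hx''⟩
    have noN : ∀ l, x ∉ N l := by
      intro l hl
      have e1 := hNV l.1 l.2 _ x hl (b4 _ _ hx)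
      have e2 := hNV l.1 l.2 _ x hl (b4 _ _ hx')
      have e3 := hNV l.1 l.2 _ x hl (b4 _ _ hx'')
      rcases e1 with e1 | e1 <;> rcases e2 with e2 | e2 <;> rcases e3 with e3 | e3
      all_goals first
        | exact n1 (e1.trans e2.symm)
        | exact n2 (e1.trans e3.symm)
        | exact n3 (e2.trans e3.symm)
    have hg : ∀ i k, x ∈ γ' i k → x ∈ Grid (F (i, k)) := by
      intro i k hx
      rcases b5 i k hx with (h | h) | h
      · exact absurd h (noN _)
      · exact absurd h (noN _)
      · exact h
    rcases hg _ _ hx with e1 | e1 <;> rcases hg _ _ hx' with e2 | e2 <;>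
      rcases hg _ _ hx'' with e3 | e3
    all_goals first
      | exact hFF _ _ n1 _ e1 e2
      | exact hFF _ _ n2 _ e1 e3
      | exact hFF _ _ n3 _ e2 e3
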